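/- (Lemma 2.) Let (X_t)_{t≥1} be a strictly stationary sequence of real random variables with absolute regularity (β-mixing) coefficient β(m). Let I = (i_1,…,i_{|I|}) with 1 ≤ i_1 < … < i_{|I|} ≤ n and I' = (i'_1,…,i'_{|I'|}) with 1 ≤ i'_1 < … < i'_{|I'|} ≤ n be finite sets of natural numbers, and let g_1 and g_2 be measurable functions of |I| and |I'| real variables with |g_1(X_i ; i∈I)| ≤ F' and |g_2(X_{i'} ; i'∈I')| ≤ F''. Suppose |i − i'| > m for every i ∈ I and i' ∈ I'. Then | E{ g_1(X_i ; i∈I) · g_2(X_{i'} ; i'∈I') } − E g_1(X_i ; i∈I) · E g_2(X_{i'} ; i'∈I') | ≤ 8 (|I| + |I'|) F' F'' β(m). -/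

import Mathlib

open MeasureTheory ProbabilityTheory Filter

noncomputable section

/-- The σ-algebra generated by the random variables `X i`, `i ∈ s`. -/
def sigmaGen {Ω : Type*} (X : ℕ → Ω → ℝ) (s : Set ℕ) : MeasurableSpace Ω :=
  ⨆ i ∈ s, MeasurableSpace.comap (X i) inferInstance

/-- The absolute regularity (β-mixing) coefficient of the sequence `(X t)_{t ≥ 1}`:
`β(m) = sup_{t ≥ 1} sup (1/2) ∑_{i,j} |P(A i ∩ B j) - P(A i) P(B j)|`, the inner supremum
being over finite partitions `{A i}` measurable w.r.t. `σ(X 1, …, X t)` and finite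
partitions `{B j}` measurable w.r.t. `σ(X s : s ≥ t + m)`. -/
def betaMixing {Ω : Type*} [MeasurableSpace Ω] (μ : Measure Ω) (X : ℕ → Ω → ℝ)
    (m : ℕ) : ℝ :=
  ⨆ t : ℕ, sSup {c : ℝ |
    ∃ (K L : ℕ) (A : Fin K → Set Ω) (B : Fin L → Set Ω),
      (∀ i, MeasurableSet[sigmaGen X (Set.Icc 1 (t + 1))] (A i)) ∧
      (∀ j, MeasurableSet[sigmaGen X (Set.Ici (t + 1 + m))] (B j)) ∧
      Pairwise (Function.onFun Disjoint A) ∧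
      Pairwise (Function.onFun Disjoint B) ∧
      (⋃ i, A i) = Set.univ ∧ (⋃ j, B j) = Set.univ ∧
      c = (1 / 2) * ∑ i : Fin K, ∑ j : Fin L,
        |(μ (A i ∩ B j)).toReal - (μ (A i)).toReal * (μ (B j)).toReal|}

/-- A sequence of real random variables is strictly stationary if all its
finite-dimensional distributions are invariant under index shifts. -/
def IsStrictlyStationary {Ω : Type*} [MeasurableSpace Ω] (μ : Measure Ω)
    (X : ℕ → Ω → ℝ) : Prop :=
  ∀ (τ k : ℕ) (t : Fin k → ℕ), (∀ i, 1 ≤ t i) →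
    μ.map (fun ω i => X (t i + τ) ω) = μ.map (fun ω i => X (t i) ω)

/-- The sets in a product space that are finite unions of cells of finite measurable grids. -/
def gridSets (E F : Type*) [MeasurableSpace E] [MeasurableSpace F] : Set (Set (E × F)) :=
  {S | ∃ (K L : ℕ) (f : E → Fin K) (g : F → Fin L) (T : Finset (Fin K × Fin L)),
    Measurable f ∧ Measurable g ∧ S = {p | (f p.1, g p.2) ∈ T}}

section Grid

variable {E F : Type*} [MeasurableSpace E] [MeasurableSpace F]

lemma prod_mem_gridSets {s : Set E} {t : Set F} (hs : MeasurableSet s) (ht : MeasurableSet t) :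
    s ×ˢ t ∈ gridSets E F := by
  classical
  refine ⟨2, 2, fun x => if x ∈ s then 1 else 0, fun y => if y ∈ t then 1 else 0, {(1, 1)},
    Measurable.ite hs measurable_const measurable_const,
    Measurable.ite ht measurable_const measurable_const, ?_⟩
  ext p
  by_cases h1 : p.1 ∈ s <;> by_cases h2 : p.2 ∈ t <;> simp [h1, h2]

lemma isSetAlgebra_gridSets : IsSetAlgebra (gridSets E F) where
  empty_mem := by
    rw [← Set.prod_empty (s := (∅ : Set E))]
    exact prod_mem_gridSets .empty .empty
  compl_mem := by
    classical
    rintro _ ⟨K, L, f, g, T, hf, hg, rfl⟩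
    refine ⟨K, L, f, g, Tᶜ, hf, hg, ?_⟩
    ext p
    simp
  union_mem := by
    classical
    rintro _ _ ⟨K, L, f, g, T, hf, hg, rfl⟩ ⟨K', L', f', g', T', hf', hg', rfl⟩
    refine ⟨K * K', L * L', fun x => finProdFinEquiv (f x, f' x),
      fun y => finProdFinEquiv (g y, g' y),
      Finset.univ.filter fun q =>
        ((finProdFinEquiv.symm q.1).1, (finProdFinEquiv.symm q.2).1) ∈ T ∨
          ((finProdFinEquiv.symm q.1).2, (finProdFinEquiv.symm q.2).2) ∈ T',
      (measurable_of_finite _).comp (hf.prodMk hf'),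
      (measurable_of_finite _).comp (hg.prodMk hg'), ?_⟩
    ext p
    simp only [Finset.mem_filter, Finset.mem_univ, true_and, Equiv.symm_apply_apply]
    rfl

lemma measurableSet_of_mem_gridSets {S : Set (E × F)} (hS : S ∈ gridSets E F) :
    MeasurableSet S := by
  obtain ⟨K, L, f, g, T, hf, hg, rfl⟩ := hS
  exact ((hf.comp measurable_fst).prodMk (hg.comp measurable_snd)) T.measurableSet

lemma generateFrom_gridSets :
    MeasurableSpace.generateFrom (gridSets E F) = Prod.instMeasurableSpace := by
  refine le_antisymm (MeasurableSpace.generateFrom_le fun S => measurableSet_of_mem_gridSets) ?_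
  rw [← generateFrom_prod]
  refine MeasurableSpace.generateFrom_mono ?_
  rintro _ ⟨s, hs, t, ht, rfl⟩
  exact prod_mem_gridSets hs ht

lemma measureReal_grid (ν : Measure (E × F)) [IsFiniteMeasure ν] {K L : ℕ} {f : E → Fin K}
    {g : F → Fin L} (hf : Measurable f) (hg : Measurable g) (T : Finset (Fin K × Fin L)) :
    ν.real {p | (f p.1, g p.2) ∈ T} =
      ∑ q ∈ T, ν.real ((f ⁻¹' {q.1}) ×ˢ (g ⁻¹' {q.2})) := by
  rw [← measureReal_biUnion_finset]
  · congr 1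
    ext p
    simp
  · intro q _ q' _ hne
    rw [Function.onFun, Set.disjoint_left]
    rintro p ⟨h1, h2⟩ ⟨h3, h4⟩
    simp only [Set.mem_preimage, Set.mem_singleton_iff] at h1 h2 h3 h4
    exact hne (Prod.ext (h1.symm.trans h3) (h2.symm.trans h4))
  · intro q _
    exact (hf (measurableSet_singleton _)).prod (hg (measurableSet_singleton _))

/-- If two finite measures on a product space differ by at most `c`, in total variation,
along every finite measurable grid, then they differ by at most `c` on every measurable set. -/
lemma abs_measureReal_sub_le_of_grid (ν₁ ν₂ : Measure (E × F)) [IsFiniteMeasure ν₁]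
    [IsFiniteMeasure ν₂] {c : ℝ}
    (h : ∀ (K L : ℕ) (f : E → Fin K) (g : F → Fin L), Measurable f → Measurable g →
      ∑ i, ∑ j, |ν₁.real ((f ⁻¹' {i}) ×ˢ (g ⁻¹' {j})) - ν₂.real ((f ⁻¹' {i}) ×ˢ (g ⁻¹' {j}))| ≤ c)
    {S : Set (E × F)} (hS : MeasurableSet S) : |ν₁.real S - ν₂.real S| ≤ c := by
  have key : ∀ S' ∈ gridSets E F, |ν₁.real S' - ν₂.real S'| ≤ c := by
    rintro _ ⟨K, L, f, g, T, hf, hg, rfl⟩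
    rw [measureReal_grid ν₁ hf hg, measureReal_grid ν₂ hf hg, ← Finset.sum_sub_distrib]
    refine (Finset.abs_sum_le_sum_abs _ _).trans (le_trans ?_ (h K L f g hf hg))
    rw [← Fintype.sum_prod_type']
    exact Finset.sum_le_sum_of_subset_of_nonneg (Finset.subset_univ _)
      fun _ _ _ => abs_nonneg _
  refine le_of_forall_pos_le_add fun ε hε => ?_
  obtain ⟨S', hS', hlt⟩ := exists_measure_symmDiff_lt_of_generateFrom_isSetRing (μ := ν₁ + ν₂)
    isSetAlgebra_gridSets.isSetRing
    ⟨{Set.univ}, Set.countable_singleton _,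
      by simpa using isSetAlgebra_gridSets.univ_mem, by simp⟩
    generateFrom_gridSets.symm hS (ENNReal.ofReal_pos.2 hε)
  have hm := (measurableSet_of_mem_gridSets hS').nullMeasurableSet (μ := ν₁)
  have hm' := (measurableSet_of_mem_gridSets hS').nullMeasurableSet (μ := ν₂)
  have h1 := abs_measureReal_sub_le_measureReal_symmDiff hm hS.nullMeasurableSet
  have h2 := abs_measureReal_sub_le_measureReal_symmDiff hm' hS.nullMeasurableSet
  have h3 : ν₁.real (symmDiff S' S) + ν₂.real (symmDiff S' S) ≤ ε := by
    rw [← measureReal_add_apply]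
    exact (ENNReal.toReal_mono ENNReal.ofReal_ne_top hlt.le).trans
      (ENNReal.toReal_ofReal hε.le).le
  have h4 := key S' hS'
  rw [abs_le] at *
  constructor <;> linarith

end Grid

/-- If two probability measures differ by at most `c` on every measurable set, then the integrals
of a function bounded by `C` differ by at most `2 * C * c`. -/
lemma abs_integral_sub_integral_le {E : Type*} [MeasurableSpace E] (ν₁ ν₂ : Measure E)
    [IsProbabilityMeasure ν₁] [IsProbabilityMeasure ν₂] {c C : ℝ}
    (hc : ∀ S, MeasurableSet S → |ν₁.real S - ν₂.real S| ≤ c)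
    {h : E → ℝ} (hh : Measurable h) (hC : ∀ x, |h x| ≤ C) :
    |∫ x, h x ∂ν₁ - ∫ x, h x ∂ν₂| ≤ 2 * C * c := by
  have hC0 : 0 ≤ C := by
    obtain ⟨x⟩ := ν₁.nonempty_of_neZero
    exact (abs_nonneg _).trans (hC x)
  have layer : ∀ (ν : Measure E) [IsProbabilityMeasure ν],
      IntegrableOn (fun t => ν.real {a | t ≤ h a + C}) (Set.Ioc 0 (2 * C)) ∧
      ∫ x, h x ∂ν = (∫ t in Set.Ioc 0 (2 * C), ν.real {a | t ≤ h a + C}) - C := by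
    intro ν _
    have hi : Integrable h ν := .of_bound hh.aestronglyMeasurable C (.of_forall hC)
    have h1 := (hi.add (integrable_const C)).integral_eq_integral_Ioc_meas_le (M := 2 * C)
      (.of_forall fun x => by have := abs_le.1 (hC x); simp; linarith)
      (.of_forall fun x => by have := abs_le.1 (hC x); simp; linarith)
    refine ⟨?_, ?_⟩
    · refine Measure.integrableOn_of_bounded (M := 1) measure_Ioc_lt_top.ne ?_
        (.of_forall fun t => ?_)
      · refine (Antitone.measurable fun s t hst => ?_).aestronglyMeasurable
        exact measureReal_mono fun a (ha : t ≤ _) => hst.trans ha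
      · rw [Real.norm_of_nonneg measureReal_nonneg]
        exact measureReal_le_one
    · simp only [Pi.add_apply] at h1
      rw [← h1, integral_add hi (integrable_const C)]
      simp
  obtain ⟨i1, e1⟩ := layer ν₁
  obtain ⟨i2, e2⟩ := layer ν₂
  rw [e1, e2, sub_sub_sub_cancel_right, ← integral_sub i1 i2]
  have := norm_setIntegral_le_of_norm_le_const (μ := volume) (s := Set.Ioc 0 (2 * C)) (C := c)
    (f := fun t => ν₁.real {a | t ≤ h a + C} - ν₂.real {a | t ≤ h a + C})
    measure_Ioc_lt_top fun t _ => hc _ (measurableSet_le measurable_const (hh.add_const C))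
  rw [Real.volume_real_Ioc_of_le (by linarith), Real.norm_eq_abs] at this
  linarith

lemma measurable_sigmaGen {Ω : Type*} {X : ℕ → Ω → ℝ} {s : Set ℕ} {i : ℕ} (hi : i ∈ s) :
    Measurable[sigmaGen X s] (X i) :=
  Measurable.of_comap_le
    (le_iSup₂_of_le (f := fun i (_ : i ∈ s) => MeasurableSpace.comap (X i) inferInstance) i hi
      le_rfl)

lemma betaMixing_nonneg {Ω : Type*} [MeasurableSpace Ω] (μ : Measure Ω) (X : ℕ → Ω → ℝ) (m : ℕ) :
    0 ≤ betaMixing μ X m := by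
  refine Real.iSup_nonneg fun t => Real.sSup_nonneg ?_
  rintro _ ⟨K, L, A, B, -, -, -, -, -, -, rfl⟩
  positivity

section Mixing

variable {Ω : Type*} [MeasurableSpace Ω] {μ : Measure Ω} [IsProbabilityMeasure μ]
  {X : ℕ → Ω → ℝ} {m : ℕ}

lemma sigmaGen_le (hX : ∀ t, Measurable (X t)) (s : Set ℕ) : sigmaGen X s ≤ ‹_› :=
  iSup₂_le fun i _ => (hX i).comap_le

lemma sum_measureReal_eq_one {K : ℕ} {A : Fin K → Set Ω} (hA : ∀ i, MeasurableSet (A i))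
    (hd : Pairwise (Function.onFun Disjoint A)) (hu : (⋃ i, A i) = Set.univ) :
    ∑ i, μ.real (A i) = 1 := by
  rw [← measureReal_iUnion_fintype hd hA, hu, probReal_univ]

lemma sum_measureReal_inter_eq {L : ℕ} {B : Fin L → Set Ω} (hB : ∀ j, MeasurableSet (B j))
    (hd : Pairwise (Function.onFun Disjoint B)) (hu : (⋃ j, B j) = Set.univ) {A : Set Ω}
    (hA : MeasurableSet A) : ∑ j, μ.real (A ∩ B j) = μ.real A := by
  rw [← measureReal_iUnion_fintype (fun i j hij => (hd hij).mono Set.inter_subset_right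
    Set.inter_subset_right) fun j => hA.inter (hB j), ← Set.inter_iUnion, hu, Set.inter_univ]

lemma sum_abs_measureReal_le_two {K L : ℕ} {A : Fin K → Set Ω} {B : Fin L → Set Ω}
    (hA : ∀ i, MeasurableSet (A i)) (hB : ∀ j, MeasurableSet (B j))
    (hAd : Pairwise (Function.onFun Disjoint A)) (hBd : Pairwise (Function.onFun Disjoint B))
    (hAu : (⋃ i, A i) = Set.univ) (hBu : (⋃ j, B j) = Set.univ) :
    ∑ i, ∑ j, |μ.real (A i ∩ B j) - μ.real (A i) * μ.real (B j)| ≤ 2 := by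
  calc ∑ i, ∑ j, |μ.real (A i ∩ B j) - μ.real (A i) * μ.real (B j)|
      ≤ ∑ i, ∑ j, (μ.real (A i ∩ B j) + μ.real (A i) * μ.real (B j)) := by
        gcongr with i _ j _
        refine (abs_sub _ _).trans (le_of_eq ?_)
        rw [abs_of_nonneg measureReal_nonneg, abs_of_nonneg (by positivity)]
    _ = 2 := by
        simp_rw [Finset.sum_add_distrib, ← Finset.mul_sum, sum_measureReal_eq_one hB hBd hBu,
          fun i => sum_measureReal_inter_eq (μ := μ) hB hBd hBu (hA i), mul_one,
          sum_measureReal_eq_one hA hAd hAu]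
        norm_num

/-- Along any pair of finite partitions of the past up to time `t + 1` and of the future from time
`t + 1 + m`, the total variation is at most twice the mixing coefficient. -/
lemma sum_abs_measureReal_le_betaMixing (hX : ∀ t, Measurable (X t)) (t : ℕ) {K L : ℕ}
    {A : Fin K → Set Ω} {B : Fin L → Set Ω}
    (hA : ∀ i, MeasurableSet[sigmaGen X (Set.Icc 1 (t + 1))] (A i))
    (hB : ∀ j, MeasurableSet[sigmaGen X (Set.Ici (t + 1 + m))] (B j))
    (hAd : Pairwise (Function.onFun Disjoint A)) (hBd : Pairwise (Function.onFun Disjoint B))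
    (hAu : (⋃ i, A i) = Set.univ) (hBu : (⋃ j, B j) = Set.univ) :
    ∑ i, ∑ j, |μ.real (A i ∩ B j) - μ.real (A i) * μ.real (B j)| ≤ 2 * betaMixing μ X m := by
  have hle : (1 / 2) * ∑ i, ∑ j, |μ.real (A i ∩ B j) - μ.real (A i) * μ.real (B j)| ≤
      betaMixing μ X m := by
    refine le_ciSup_of_le ⟨1, ?_⟩ t (le_csSup ⟨1, ?_⟩ ⟨K, L, A, B, hA, hB, hAd, hBd, hAu, hBu, rfl⟩)
    · rintro _ ⟨s, rfl⟩
      refine Real.sSup_le ?_ zero_le_one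
      rintro _ ⟨K, L, A, B, hA, hB, hAd, hBd, hAu, hBu, rfl⟩
      have := sum_abs_measureReal_le_two (μ := μ) (fun i => sigmaGen_le hX _ _ (hA i))
        (fun j => sigmaGen_le hX _ _ (hB j)) hAd hBd hAu hBu
      simp only [measureReal_def] at this
      linarith
    · rintro _ ⟨K, L, A, B, hA, hB, hAd, hBd, hAu, hBu, rfl⟩
      have := sum_abs_measureReal_le_two (μ := μ) (fun i => sigmaGen_le hX _ _ (hA i))
        (fun j => sigmaGen_le hX _ _ (hB j)) hAd hBd hAu hBu
      simp only [measureReal_def] at this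
      linarith
  linarith

/-- A bounded function of a past variable `U` and a future variable `V` changes its mean by at most
`4 * C * β(m)` when `V` is replaced by an independent copy. -/
lemma abs_integral_sub_integral_integral_le (hX : ∀ t, Measurable (X t)) (t : ℕ)
    {E F : Type*} [MeasurableSpace E] [MeasurableSpace F] {U : Ω → E} {V : Ω → F}
    (hU : Measurable[sigmaGen X (Set.Icc 1 (t + 1))] U)
    (hV : Measurable[sigmaGen X (Set.Ici (t + 1 + m))] V)
    {h : E × F → ℝ} (hh : Measurable h) {C : ℝ} (hC : ∀ p, |h p| ≤ C) :
    |∫ ω, h (U ω, V ω) ∂μ - ∫ ω', ∫ ω, h (U ω, V ω') ∂μ ∂μ| ≤ 4 * C * betaMixing μ X m := by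
  have hU' : Measurable U := hU.mono (sigmaGen_le hX _) le_rfl
  have hV' : Measurable V := hV.mono (sigmaGen_le hX _) le_rfl
  have : IsProbabilityMeasure (μ.map U) := Measure.isProbabilityMeasure_map hU'.aemeasurable
  have : IsProbabilityMeasure (μ.map V) := Measure.isProbabilityMeasure_map hV'.aemeasurable
  have : IsProbabilityMeasure (μ.map fun ω => (U ω, V ω)) :=
    Measure.isProbabilityMeasure_map (hU'.prodMk hV').aemeasurable
  have e1 : ∫ ω, h (U ω, V ω) ∂μ = ∫ p, h p ∂(μ.map fun ω => (U ω, V ω)) :=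
    (integral_map (hU'.prodMk hV').aemeasurable hh.aestronglyMeasurable).symm
  have e2 : ∫ ω', ∫ ω, h (U ω, V ω') ∂μ ∂μ = ∫ p, h p ∂((μ.map U).prod (μ.map V)) := by
    rw [integral_prod_symm _ (.of_bound hh.aestronglyMeasurable C (.of_forall hC)),
      integral_map hV'.aemeasurable
        hh.stronglyMeasurable.integral_prod_left'.aestronglyMeasurable]
    refine integral_congr_ae (.of_forall fun ω' => ?_)
    exact (integral_map hU'.aemeasurable
      (hh.comp measurable_prodMk_right).aestronglyMeasurable).symm
  rw [e1, e2]
  have := abs_integral_sub_integral_le (μ.map fun ω => (U ω, V ω)) ((μ.map U).prod (μ.map V))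
    (fun S hS => abs_measureReal_sub_le_of_grid _ _ (c := 2 * betaMixing μ X m) ?_ hS) hh hC
  · linarith
  intro K L f g hf hg
  convert! sum_abs_measureReal_le_betaMixing (μ := μ) (m := m) hX t
    (A := fun i => (f ∘ U) ⁻¹' {i}) (B := fun j => (g ∘ V) ⁻¹' {j})
    (fun i => (hf.comp hU) (measurableSet_singleton i))
    (fun j => (hg.comp hV) (measurableSet_singleton j))
    (fun i j hij => Disjoint.preimage _ (Set.disjoint_singleton.2 hij))
    (fun i j hij => Disjoint.preimage _ (Set.disjoint_singleton.2 hij))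
    (by ext; simp) (by ext; simp) using 7 with i _ j _
  · rw [map_measureReal_apply (hU'.prodMk hV')
      ((hf (measurableSet_singleton _)).prod (hg (measurableSet_singleton _)))]
    rfl
  · rw [measureReal_prod_prod, map_measureReal_apply hU' (hf (measurableSet_singleton _)),
      map_measureReal_apply hV' (hg (measurableSet_singleton _))]
    rfl

lemma abs_integral_le_of_forall_abs_le {f : Ω → ℝ} {C : ℝ} (h : ∀ ω, |f ω| ≤ C) :
    |∫ ω, f ω ∂μ| ≤ C := by
  simpa using norm_integral_le_of_norm_le_const (μ := μ) (f := f) (.of_forall h)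

/-- Removing from `I'` the indices beyond the largest index of `I` costs `8 * a * b * β(m)` in the
covariance bound. -/
lemma abs_covariance_le_of_forall_filter_le (hX : ∀ t, Measurable (X t)) {I I' : Finset ℕ}
    (hI : ∀ i ∈ I, 1 ≤ i) (hI' : ∀ i ∈ I', 1 ≤ i) {M : ℕ} (hM : M ∈ I) (hmax : ∀ i ∈ I, i ≤ M)
    (hsep : ∀ i ∈ I', M < i → M + m ≤ i) {G₁ G₂ : (ℕ → ℝ) → ℝ} (hG₁ : Measurable G₁)
    (hG₂ : Measurable G₂) (hd₁ : DependsOn G₁ I) (hd₂ : DependsOn G₂ I') {a b D : ℝ}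
    (ha : ∀ x, |G₁ x| ≤ a) (hb : ∀ x, |G₂ x| ≤ b)
    (hD : ∀ G : (ℕ → ℝ) → ℝ, Measurable G → DependsOn G (I'.filter (· ≤ M)) →
      (∀ x, |G x| ≤ b) →
      |∫ ω, G₁ (X · ω) * G (X · ω) ∂μ - (∫ ω, G₁ (X · ω) ∂μ) * ∫ ω, G (X · ω) ∂μ| ≤ D) :
    |∫ ω, G₁ (X · ω) * G₂ (X · ω) ∂μ - (∫ ω, G₁ (X · ω) ∂μ) * ∫ ω, G₂ (X · ω) ∂μ| ≤
      D + 8 * a * b * betaMixing μ X m := by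
  have ha0 : 0 ≤ a := (abs_nonneg _).trans (ha 0)
  have hb0 : 0 ≤ b := (abs_nonneg _).trans (hb 0)
  have hβ := betaMixing_nonneg μ X m
  obtain ⟨t, rfl⟩ : ∃ t, M = t + 1 := ⟨M - 1, by have := hI M hM; omega⟩
  set U : Ω → ℕ → ℝ := fun ω i => if i ∈ Set.Icc 1 (t + 1) then X i ω else 0 with hU_def
  set V : Ω → ℕ → ℝ := fun ω i => if i ∈ Set.Ici (t + 1 + m) then X i ω else 0 with hV_def
  set H : (ℕ → ℝ) × (ℕ → ℝ) → ℝ := fun p => G₂ fun i => if i ≤ t + 1 then p.1 i else p.2 i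
    with hH_def
  have hU : Measurable[sigmaGen X (Set.Icc 1 (t + 1))] U := by
    refine @measurable_pi_lambda _ _ _ (_) _ _ fun i => ?_
    by_cases hi : i ∈ Set.Icc 1 (t + 1)
    · simpa only [hU_def, if_pos hi] using measurable_sigmaGen hi
    · simpa only [hU_def, if_neg hi] using measurable_const
  have hV : Measurable[sigmaGen X (Set.Ici (t + 1 + m))] V := by
    refine @measurable_pi_lambda _ _ _ (_) _ _ fun i => ?_
    by_cases hi : i ∈ Set.Ici (t + 1 + m)
    · simpa only [hV_def, if_pos hi] using measurable_sigmaGen hi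
    · simpa only [hV_def, if_neg hi] using measurable_const
  have hU' : Measurable U := hU.mono (sigmaGen_le hX _) le_rfl
  have hV' : Measurable V := hV.mono (sigmaGen_le hX _) le_rfl
  have hH : Measurable H := by
    refine hG₂.comp (measurable_pi_lambda _ fun i => ?_)
    split_ifs <;> fun_prop
  have hHb : ∀ p, |H p| ≤ b := fun p => hb _
  have eG₁ : ∀ ω, G₁ (X · ω) = G₁ (U ω) := fun ω => hd₁ fun i hi => by
    simp [hU_def, hI i hi, hmax i hi]
  have eH : ∀ ω ω', H ((X · ω), V ω') = H (U ω, V ω') := fun ω ω' => hd₂ fun i hi => by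
    by_cases h : i ≤ t + 1 <;> simp [hU_def, hI' i hi, h]
  have eG₂ : ∀ ω, G₂ (X · ω) = H (U ω, V ω) := fun ω => hd₂ fun i hi => by
    by_cases h : i ≤ t + 1
    · simp [hU_def, hI' i hi, h]
    · simp [hV_def, h, hsep i hi (not_le.1 h)]
  have hprod : ∀ p : (ℕ → ℝ) × (ℕ → ℝ), |G₁ p.1 * H p| ≤ a * b := fun p => by
    rw [abs_mul]
    exact mul_le_mul (ha _) (hHb _) (abs_nonneg _) ha0
  have s1 := abs_integral_sub_integral_integral_le (μ := μ) (m := m) hX t hU hV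
    ((hG₁.comp measurable_fst).mul hH) hprod
  have s2 := abs_integral_sub_integral_integral_le (μ := μ) (m := m) hX t hU hV hH hHb
  have hm₁ : Measurable fun q : Ω × Ω => G₁ (U q.2) * H (U q.2, V q.1) := by fun_prop
  have hm₂ : Measurable fun q : Ω × Ω => H (U q.2, V q.1) := by fun_prop
  have i₁ : Integrable (fun ω' => ∫ ω, G₁ (U ω) * H (U ω, V ω') ∂μ) μ :=
    (Integrable.of_bound (μ := μ.prod μ) hm₁.aestronglyMeasurable (a * b)
      (.of_forall fun q => hprod (U q.2, V q.1))).integral_prod_left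
  have i₂ : Integrable (fun ω' => ∫ ω, H (U ω, V ω') ∂μ) μ :=
    (Integrable.of_bound (μ := μ.prod μ) hm₂.aestronglyMeasurable b
      (.of_forall fun q => hHb (U q.2, V q.1))).integral_prod_left
  have s3 : |∫ ω', ∫ ω, G₁ (U ω) * H (U ω, V ω') ∂μ ∂μ -
      (∫ ω, G₁ (U ω) ∂μ) * ∫ ω', ∫ ω, H (U ω, V ω') ∂μ ∂μ| ≤ D := by
    rw [← integral_const_mul, ← integral_sub i₁ (i₂.const_mul _)]
    refine abs_integral_le_of_forall_abs_le fun ω' => ?_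
    have := hD (fun x => H (x, V ω')) (by fun_prop) ?_ fun x => hHb _
    · simpa only [eH, eG₁] using this
    intro x y hxy
    refine hd₂ fun i hi => ?_
    by_cases h : i ≤ t + 1
    · simpa [h] using hxy i (by simpa using ⟨hi, h⟩)
    · simp [h]
  have s4 : |∫ ω, G₁ (U ω) ∂μ| ≤ a := abs_integral_le_of_forall_abs_le fun ω => ha _
  have s5 : |(∫ ω, G₁ (U ω) ∂μ) * (∫ ω, H (U ω, V ω) ∂μ - ∫ ω', ∫ ω, H (U ω, V ω') ∂μ ∂μ)| ≤
      a * (4 * b * betaMixing μ X m) := by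
    rw [abs_mul]
    exact mul_le_mul s4 s2 (abs_nonneg _) ha0
  simp only [eG₁, eG₂]
  rw [mul_sub] at s5
  simp only [Pi.mul_apply, Function.comp_apply] at s1
  rw [abs_le] at *
  constructor <;> linarith

/-- Covariance bound for bounded functions of two separated groups of variables, by induction on
the number of variables: the group with the largest index loses its last block. -/
lemma abs_covariance_le_of_card_le (hX : ∀ t, Measurable (X t)) (k : ℕ) (I I' : Finset ℕ)
    (hk : I.card + I'.card ≤ k) (hI : ∀ i ∈ I, 1 ≤ i) (hI' : ∀ i ∈ I', 1 ≤ i)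
    (hsep : ∀ i ∈ I, ∀ i' ∈ I', (m : ℤ) < |(i : ℤ) - (i' : ℤ)|) {G₁ G₂ : (ℕ → ℝ) → ℝ}
    (hG₁ : Measurable G₁) (hG₂ : Measurable G₂) (hd₁ : DependsOn G₁ I) (hd₂ : DependsOn G₂ I')
    {a b : ℝ} (ha : ∀ x, |G₁ x| ≤ a) (hb : ∀ x, |G₂ x| ≤ b) :
    |∫ ω, G₁ (X · ω) * G₂ (X · ω) ∂μ - (∫ ω, G₁ (X · ω) ∂μ) * ∫ ω, G₂ (X · ω) ∂μ| ≤
      8 * k * a * b * betaMixing μ X m := by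
  have ha0 : 0 ≤ a := (abs_nonneg _).trans (ha 0)
  have hb0 : 0 ≤ b := (abs_nonneg _).trans (hb 0)
  have hβ := betaMixing_nonneg μ X m
  induction k generalizing I I' G₁ G₂ a b with
  | zero =>
    obtain rfl : I = ∅ := Finset.card_eq_zero.1 (by omega)
    have e : ∀ ω, G₁ (X · ω) = G₁ 0 := fun ω => hd₁ (by simp)
    simp [e, integral_const_mul]
  | succ k ih =>
    rcases I.eq_empty_or_nonempty with rfl | hne
    · have e : ∀ ω, G₁ (X · ω) = G₁ 0 := fun ω => hd₁ (by simp)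
      simp only [e, integral_const_mul, integral_const, probReal_univ, one_smul, sub_self, abs_zero]
      positivity
    rcases I'.eq_empty_or_nonempty with rfl | hne'
    · have e : ∀ ω, G₂ (X · ω) = G₂ 0 := fun ω => hd₂ (by simp)
      simp only [e, integral_mul_const, integral_const, probReal_univ, one_smul, sub_self, abs_zero]
      positivity
    wlog hlt : I.max' hne < I'.max' hne' generalizing I I' G₁ G₂ a b
    · have hne_max : I.max' hne ≠ I'.max' hne' := fun h => by
        have := hsep _ (I.max'_mem hne) _ (I'.max'_mem hne')
        rw [h] at this
        simp at this
        omega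
      have := this I' I (by omega) hI' hI
        (fun i hi i' hi' => by rw [abs_sub_comm]; exact hsep i' hi' i hi)
        hG₂ hG₁ hd₂ hd₁ hb ha hb0 ha0 hne' hne (by omega)
      simp only [mul_comm (G₁ _)]
      rw [mul_comm (∫ ω, G₁ _ ∂μ)]
      linarith
    have hcard : (I'.filter (· ≤ I.max' hne)).card < I'.card :=
      Finset.card_lt_card (Finset.filter_ssubset.2 ⟨_, I'.max'_mem hne', not_le.2 hlt⟩)
    have := abs_covariance_le_of_forall_filter_le (μ := μ) (m := m)
      (D := 8 * k * a * b * betaMixing μ X m) hX hI hI' (I.max'_mem hne) (I.le_max' · ·)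
      (fun i hi h => by
        have := hsep _ (I.max'_mem hne) i hi
        rw [abs_of_neg (by omega)] at this
        omega)
      hG₁ hG₂ hd₁ hd₂ ha hb fun G hG hd hGb =>
        ih I _ (by omega) hI (fun i hi => hI' i (Finset.mem_of_mem_filter i hi))
          (fun i hi i' hi' => hsep i hi i' (Finset.mem_of_mem_filter i' hi')) hG₁ hG hd₁ hd
          ha hGb ha0 hb0
    push_cast
    linarith

end Mixing

/-- Lemma 2: covariance-type bound for bounded functions of two groups of variables
whose index sets are separated by more than `m`. -/
theorem lemma2_covariance_bound
    {Ω : Type*} [MeasurableSpace Ω] (μ : Measure Ω) [IsProbabilityMeasure μ]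
    (X : ℕ → Ω → ℝ) (hXmeas : ∀ t, Measurable (X t))
    (hstat : IsStrictlyStationary μ X)
    (n m : ℕ) (I I' : Finset ℕ)
    (hI : ∀ i ∈ I, i ∈ Finset.Icc 1 n) (hI' : ∀ i ∈ I', i ∈ Finset.Icc 1 n)
    -- separation: `|i - i'| > m` for every `i ∈ I`, `i' ∈ I'`
    (hsep : ∀ i ∈ I, ∀ i' ∈ I', (m : ℤ) < |(i : ℤ) - (i' : ℤ)|)
    (g₁ : (↥I → ℝ) → ℝ) (g₂ : (↥I' → ℝ) → ℝ)
    (hg₁ : Measurable g₁) (hg₂ : Measurable g₂)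
    (F' F'' : ℝ)
    (hb₁ : ∀ x, |g₁ x| ≤ F') (hb₂ : ∀ x, |g₂ x| ≤ F'') :
    |∫ ω, g₁ (fun i => X i.1 ω) * g₂ (fun i' => X i'.1 ω) ∂μ -
        (∫ ω, g₁ (fun i => X i.1 ω) ∂μ) * ∫ ω, g₂ (fun i' => X i'.1 ω) ∂μ| ≤
      8 * ((I.card : ℝ) + I'.card) * F' * F'' * betaMixing μ X m := by
  have := abs_covariance_le_of_card_le (μ := μ) (m := m) hXmeas (I.card + I'.card) I I' le_rfl
    (fun i hi => (Finset.mem_Icc.1 (hI i hi)).1) (fun i hi => (Finset.mem_Icc.1 (hI' i hi)).1) hsep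
    (G₁ := fun x => g₁ fun i => x i) (G₂ := fun x => g₂ fun i => x i)
    (by fun_prop) (by fun_prop)
    (fun x y h => congrArg g₁ (funext fun i => h i i.2))
    (fun x y h => congrArg g₂ (funext fun i => h i i.2))
    (fun x => hb₁ _) (fun x => hb₂ _)
  exact_mod_cast this
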